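/- For every α ∈ [0,1] and every ε > 0 there exists K such that for all integers k ≥ K the following holds: if x₁,…,x_k ∈ [0,1] satisfy, for every j ∈ {1,…,k}, Σ_{ℓ=1}^{j−1} x_ℓ + (k−j+1)·x_j ≤ α·k + j, then Σ_{j=1}^{k} x_j ≤ (α + 1 − e^{α−1} + ε)·k. (Equivalently, the total increase Σ_j x_j − α·k is at most (1 − e^{α−1} + o(1))·k.) -/

import Mathlib

/-- If `S` is the sequence of partial sums of `x`, the constraints force the slack `α k + j - S j`
to be at least `(k - j) (α + log (k + 1) - log (k + 1 - j))`. -/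
theorem sub_mul_add_log_le_slack (α : ℝ) (k : ℕ) (x : ℕ → ℝ)
    (hx : ∀ j ∈ Finset.Icc 1 k,
      (∑ ℓ ∈ Finset.Icc 1 (j - 1), x ℓ) + ((k:ℝ) - j + 1) * x j ≤ α * k + j)
    (j : ℕ) (hj : j ≤ k) :
    ((k:ℝ) - j) * (α + Real.log (k + 1) - Real.log (k + 1 - j)) ≤
      α * k + j - ∑ ℓ ∈ Finset.Icc 1 j, x ℓ := by
  induction j with
  | zero => simp [mul_comm]
  | succ j ih =>
    have ih := ih (by omega)
    have h := hx (j + 1) (Finset.mem_Icc.2 ⟨by omega, hj⟩)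
    rw [Finset.sum_Icc_succ_top (by omega)]
    simp only [Nat.add_sub_cancel] at h
    push_cast at h ⊢
    have hm : (1:ℝ) ≤ k - j := by
      have : (j:ℝ) + 1 ≤ k := by exact_mod_cast hj
      linarith
    obtain ⟨m, hm_def⟩ : ∃ m : ℝ, m = k - j := ⟨_, rfl⟩
    rw [← hm_def] at ih hm
    have e1 : (k:ℝ) + 1 - j = m + 1 := by linarith
    have e2 : (k:ℝ) + 1 - (j + 1) = m := by linarith
    have e3 : (k:ℝ) - (j + 1) = m - 1 := by linarith
    have e4 : (k:ℝ) - (j + 1) + 1 = m := by linarith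
    rw [e1] at ih
    rw [e4] at h
    rw [e2, e3]
    have hm0 : 0 < m := by linarith
    have hlog : m * (Real.log (m + 1) - Real.log m) ≤ 1 := by
      rw [← Real.log_div (by linarith) hm0.ne']
      have := Real.log_le_sub_one_of_pos (x := (m + 1) / m) (by positivity)
      calc m * Real.log ((m + 1) / m) ≤ m * ((m + 1) / m - 1) := by gcongr
        _ = 1 := by field_simp; ring
    refine le_of_mul_le_mul_left ?_ hm0
    have := mul_le_mul_of_nonneg_left (add_le_add ih hlog) (sub_nonneg.2 hm)
    linarith

theorem upper_triangle_bound
    (α : ℝ) (hα : α ∈ Set.Icc (0:ℝ) 1) (ε : ℝ) (hε : 0 < ε) :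
    ∃ K : ℕ, ∀ k : ℕ, K ≤ k →
      ∀ x : ℕ → ℝ,
        (∀ j ∈ Finset.Icc 1 k, x j ∈ Set.Icc (0:ℝ) 1) →
        (∀ j ∈ Finset.Icc 1 k,
          (∑ ℓ ∈ Finset.Icc 1 (j - 1), x ℓ) + ((k:ℝ) - j + 1) * x j ≤ α * k + j) →
        ∑ j ∈ Finset.Icc 1 k, x j ≤ (α + 1 - Real.exp (α - 1) + ε) * k := by
  obtain ⟨c, hc⟩ : ∃ c, c = Real.exp (α - 1) := ⟨_, rfl⟩
  have hc0 : 0 < c := hc ▸ Real.exp_pos _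
  have hc1 : c ≤ 1 := hc ▸ Real.exp_le_one_iff.2 (by linarith [hα.2])
  refine ⟨max ⌈1 / c⌉₊ ⌈2 / ε⌉₊, fun k hk x hx01 hx => ?_⟩
  have hkc : 1 ≤ k * c := (div_le_iff₀ hc0).1 (Nat.ceil_le.1 (le_of_max_le_left hk))
  have hkε : 2 ≤ k * ε := (div_le_iff₀ hε).1 (Nat.ceil_le.1 (le_of_max_le_right hk))
  obtain ⟨n, hn⟩ : ∃ n : ℕ, ⌊((k:ℝ) + 1) * c⌋₊ = n + 1 :=
    Nat.exists_eq_succ_of_ne_zero (Nat.floor_pos.2 (by linarith)).ne'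
  have hn_le : (n:ℝ) + 1 ≤ (k + 1) * c := by
    have := Nat.floor_le (a := ((k:ℝ) + 1) * c) (by positivity)
    rw [hn] at this
    exact_mod_cast this
  have hn_lt : ((k:ℝ) + 1) * c < n + 2 := by
    have := Nat.lt_floor_add_one (((k:ℝ) + 1) * c)
    rw [hn] at this
    push_cast at this
    linarith
  have hnk : n ≤ k := by
    have : (n:ℝ) + 1 ≤ k + 1 := hn_le.trans (mul_le_of_le_one_right (by positivity) hc1)
    exact_mod_cast (by linarith : (n:ℝ) ≤ k)
  have hslack := sub_mul_add_log_le_slack α k x hx (k - n) (Nat.sub_le k n)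
  rw [Nat.cast_sub hnk, sub_sub_cancel, show (k:ℝ) + 1 - (k - n) = n + 1 by ring] at hslack
  have hlog : Real.log (n + 1) ≤ Real.log (k + 1) + (α - 1) := by
    have := Real.log_le_log (by positivity) hn_le
    rwa [Real.log_mul (by positivity) hc0.ne', hc, Real.log_exp] at this
  have hn_slack : (n:ℝ) ≤ n * (α + Real.log (k + 1) - Real.log (n + 1)) :=
    le_mul_of_one_le_right (by positivity) (by linarith)
  have htail : ∑ j ∈ Finset.Icc 1 k, x j ≤ ∑ j ∈ Finset.Icc 1 (k - n), x j + n := by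
    have hsub : Finset.Icc 1 (k - n) ⊆ Finset.Icc 1 k :=
      Finset.Icc_subset_Icc_right (Nat.sub_le k n)
    rw [← Finset.sum_sdiff hsub, add_comm]
    gcongr
    refine (Finset.sum_le_card_nsmul _ _ 1
      fun j hj => (hx01 j (Finset.mem_sdiff.1 hj).1).2).trans ?_
    rw [Finset.card_sdiff_of_subset hsub]
    simp [Nat.sub_sub_self hnk]
  rw [← hc]
  linarith
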